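/- Let G be a group generated by a finite set X of n involutions (x·x = 1 for all x ∈ X) such that x·y·x ∈ X for all x, y ∈ X. Then G is a finite group and |G| ≤ Σ_{k=0}^{n} n!/(n−k)!. -/

import Mathlib

/-- Conjugation by an involution distributes over the product of a list. -/
theorem List.prod_map_mul_mul_of_mul_self_eq_one {M : Type*} [Monoid M] {x : M} (hx : x * x = 1)
    (l : List M) : (l.map fun y => x * y * x).prod = x * l.prod * x := by
  induction l with
  | nil => simp [hx]
  | cons y l ih =>
    calc ((y :: l).map fun y => x * y * x).prod = x * y * (x * x) * l.prod * x := by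
          rw [List.map_cons, List.prod_cons, ih]
          simp only [mul_assoc]
      _ = x * (y :: l).prod * x := by simp only [hx, mul_one, List.prod_cons, mul_assoc]

/-- A word with a repeated letter, over a set of involutions closed under conjugation by its own
elements, has the same product as a strictly shorter word. -/
theorem exists_shorter_list_prod_eq_of_not_nodup {M : Type*} [Monoid M] {s : Set M}
    (hinv : ∀ x ∈ s, x * x = 1) (hconj : ∀ x ∈ s, ∀ y ∈ s, x * y * x ∈ s)
    {l : List M} (hl : ∀ x ∈ l, x ∈ s) (hdup : ¬ l.Nodup) :
    ∃ l' : List M, (∀ x ∈ l', x ∈ s) ∧ l'.prod = l.prod ∧ l'.length < l.length := by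
  simp only [List.nodup_iff_sublist, not_forall, not_not] at hdup
  obtain ⟨x, hx⟩ := hdup
  obtain ⟨r₁, r₂, rfl, h₁, h₂⟩ := List.cons_sublist_iff.1 hx
  obtain ⟨p, q, rfl⟩ := List.append_of_mem h₁
  obtain ⟨u, v, rfl⟩ := List.append_of_mem (List.singleton_sublist.1 h₂)
  have hxs : x ∈ s := hl x (by simp)
  refine ⟨p ++ (q ++ u).map (fun y => x * y * x) ++ v, fun z hz => ?_, ?_, ?_⟩
  · rw [List.mem_append, List.mem_append, List.mem_map] at hz
    rcases hz with (hz | ⟨y, hy, rfl⟩) | hz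
    · exact hl z (by simp [hz])
    · refine hconj x hxs y (hl y ?_)
      rcases List.mem_append.1 hy with hy | hy <;> simp [hy]
    · exact hl z (by simp [hz])
  · rw [List.prod_append, List.prod_append, List.prod_map_mul_mul_of_mul_self_eq_one (hinv x hxs)]
    simp [mul_assoc]
  · simp

/-- Every word over a set of involutions closed under conjugation by its own elements has the same
product as a word without repeated letters. -/
theorem exists_nodup_list_prod_eq {M : Type*} [Monoid M] {s : Set M}
    (hinv : ∀ x ∈ s, x * x = 1) (hconj : ∀ x ∈ s, ∀ y ∈ s, x * y * x ∈ s)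
    (l : List M) (hl : ∀ x ∈ l, x ∈ s) :
    ∃ l' : List M, (∀ x ∈ l', x ∈ s) ∧ l'.Nodup ∧ l'.prod = l.prod := by
  by_cases hdup : l.Nodup
  · exact ⟨l, hl, hdup, rfl⟩
  · obtain ⟨l₁, hl₁, hprod, hlt⟩ := exists_shorter_list_prod_eq_of_not_nodup hinv hconj hl hdup
    obtain ⟨l₂, hl₂, hnodup, hprod₂⟩ := exists_nodup_list_prod_eq hinv hconj l₁ hl₁
    exact ⟨l₂, hl₂, hnodup, hprod₂.trans hprod⟩
termination_by l.length

/-- If every element of a monoid is the product of a list of distinct elements of a finite set,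
then it is the product of an injective sequence indexed by some `Fin k` with `k` at most the
cardinality of that set. -/
theorem surjective_prod_ofFn_of_nodup {M : Type*} [Monoid M] (X : Finset M)
    (h : ∀ g : M, ∃ l : List M, (∀ x ∈ l, x ∈ X) ∧ l.Nodup ∧ l.prod = g) :
    Function.Surjective fun w : Σ k : Fin (X.card + 1), Fin k ↪ X =>
      (List.ofFn fun i => (w.2 i : M)).prod := by
  classical
  intro g
  obtain ⟨l, hl, hnodup, rfl⟩ := h g
  have hlen : l.length ≤ X.card := by
    rw [← List.toFinset_card_of_nodup hnodup]
    exact Finset.card_le_card fun x hx => hl x (List.mem_toFinset.1 hx)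
  refine ⟨⟨⟨l.length, Nat.lt_succ_of_le hlen⟩,
    ⟨fun i => ⟨l.get i, hl _ (l.get_mem i)⟩, fun i j hij => ?_⟩⟩, ?_⟩
  · exact List.nodup_iff_injective_get.1 hnodup (congrArg Subtype.val hij)
  · exact congrArg List.prod (List.ofFn_get l)

/-- If a group `G` is generated by a set `X` of `n` involutions closed under
conjugation by its own elements, then `G` is finite of order at most
`Σ_{k=0}^{n} n!/(n-k)!`. -/
theorem order_bound_for_group_generated_by_involutions
    {G : Type*} [Group G] (X : Finset G) (n : ℕ) (hcard : X.card = n)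
    (hgen : Subgroup.closure (X : Set G) = ⊤)
    (hinv : ∀ x ∈ X, x * x = 1)
    (hconj : ∀ x ∈ X, ∀ y ∈ X, x * y * x ∈ X) :
    Finite G ∧
      Nat.card G ≤ ∑ k ∈ Finset.range (n + 1), n.factorial / (n - k).factorial := by
  classical
  subst hcard
  have hword : ∀ g : G, ∃ l : List G, (∀ x ∈ l, x ∈ X) ∧ l.Nodup ∧ l.prod = g := by
    intro g
    have hg : g ∈ Submonoid.closure ((X : Set G) ∪ (X : Set G)⁻¹) := by
      rw [← Subgroup.closure_toSubmonoid, hgen]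
      exact Subgroup.mem_top g
    obtain ⟨l, hl, rfl⟩ := Submonoid.exists_list_of_mem_closure hg
    refine exists_nodup_list_prod_eq (s := (X : Set G)) hinv hconj l fun x hx => ?_
    rcases hl x hx with h | h
    · exact h
    · have hx' : x⁻¹ * x⁻¹ = 1 := hinv _ h
      rwa [Set.mem_inv, eq_inv_of_mul_eq_one_left hx', inv_inv] at h
  have hsurj := surjective_prod_ofFn_of_nodup X hword
  refine ⟨Finite.of_surjective _ hsurj, (Nat.card_le_card_of_surjective _ hsurj).trans_eq ?_⟩
  rw [Nat.card_eq_fintype_card, Fintype.card_sigma, ← Fin.sum_univ_eq_sum_range]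
  refine Finset.sum_congr rfl fun k _ => ?_
  rw [Fintype.card_embedding_eq, Fintype.card_coe, Fintype.card_fin,
    Nat.descFactorial_eq_div (Nat.le_of_lt_succ k.2)]
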